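/- arXiv:2102.06469 — 2 statements merged into one kernel-verified Lean document; each statement's English description precedes it below -/
import Mathlib

section
/- Let $a<b$, $T=b-a$, $t\in(a,b)$, and for $m\in\mathbb{Z}$ set $e_m(x)=e^{\mathrm{i}2m\pi x/T}$ and $f_m(x)=\dfrac{\cos\frac{\pi(x-t)}{T}}{\sin^{3}\frac{\pi(x-t)}{T}}\,e_m(x)$ for $x\ne t$. Then the Hadamard finite part of $\int_a^b f_m(x)\,dx$, namely the limit $\lim_{\varepsilon\to 0^{+}}\Big[\int_a^{t-\varepsilon} f_m(x)\,dx+\int_{t+\varepsilon}^{b} f_m(x)\,dx-\mathrm{i}\,\frac{4mT^{2}}{\pi^{2}}\,\frac{e_m(t)}{\varepsilon}\Big]$, exists and equals $-\mathrm{i}\,\mathrm{sgn}(m)\,2T m^{2}\,e_m(t)$, where $\mathrm{sgn}(0)=0$. -/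
open Filter Topology Set intervalIntegral

/-- The character `u ↦ exp (2 i m u)`. -/
noncomputable def evenCharacter (m : ℤ) (u : ℝ) : ℂ := Complex.exp (2 * Complex.I * m * u)

lemma evenCharacter_hasDerivAt (m : ℤ) (u : ℝ) :
    HasDerivAt (evenCharacter m) (2 * Complex.I * m * evenCharacter m u) u := by
  have h : HasDerivAt (fun x : ℝ => 2 * Complex.I * m * (x : ℂ)) (2 * Complex.I * m * 1) u :=
    (Complex.ofRealCLM.hasDerivAt (x := u)).const_mul _
  refine h.cexp.congr_deriv ?_
  simp only [evenCharacter]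
  ring

lemma evenCharacter_continuous (m : ℤ) : Continuous (evenCharacter m) := by
  unfold evenCharacter
  fun_prop

lemma evenCharacter_add_pi (m : ℤ) (u : ℝ) :
    evenCharacter m (u + Real.pi) = evenCharacter m u := by
  unfold evenCharacter
  push_cast
  rw [Complex.exp_eq_exp_iff_exists_int]
  exact ⟨m, by ring⟩

lemma evenCharacter_pi_sub (m : ℤ) (u : ℝ) :
    evenCharacter m (Real.pi - u) = evenCharacter m (-u) := by
  rw [← evenCharacter_add_pi m (-u)]
  congr 1
  ring

lemma evenCharacter_succ (m : ℤ) (u : ℝ) :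
    evenCharacter (m + 1) u =
      evenCharacter m u * (Complex.cos u + Complex.sin u * Complex.I) ^ 2 := by
  rw [← Complex.exp_mul_I, ← Complex.exp_nat_mul, evenCharacter, evenCharacter, ← Complex.exp_add]
  congr 1
  push_cast
  ring

lemma evenCharacter_eq (m : ℤ) (u : ℝ) :
    evenCharacter m u = Real.cos (2 * m * u) + Real.sin (2 * m * u) * Complex.I := by
  push_cast
  rw [← Complex.exp_mul_I, evenCharacter]
  congr 1
  ring

lemma integral_evenCharacter (m : ℤ) :
    ∫ u in (0 : ℝ)..Real.pi, evenCharacter m u = if m = 0 then (Real.pi : ℂ) else 0 := by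
  split_ifs with h
  · subst h
    simp [evenCharacter]
  · have hc : (2 * Complex.I * m : ℂ) ≠ 0 := by simp [h]
    have := evenCharacter_add_pi m 0
    simp only [evenCharacter, zero_add] at this ⊢
    rw [integral_exp_mul_complex hc, this, sub_self, zero_div]

lemma tendsto_integral_shrinking {g : ℝ → ℂ} (hg : Continuous g) (c d : ℝ) :
    Tendsto (fun δ : ℝ => ∫ u in (c + δ)..(d - δ), g u) (𝓝[>] 0) (𝓝 (∫ u in c..d, g u)) := by
  have h1 : Continuous (fun x : ℝ => ∫ u in (0 : ℝ)..x, g u) :=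
    continuous_primitive (fun _ _ => hg.intervalIntegrable _ _) 0
  have h2 : Continuous (fun δ : ℝ => (∫ u in (0 : ℝ)..(d - δ), g u) - ∫ u in (0 : ℝ)..(c + δ), g u) :=
    (h1.comp (continuous_const.sub continuous_id)).sub (h1.comp (continuous_const.add continuous_id))
  have h3 := (h2.tendsto 0).mono_left (nhdsWithin_le_nhds (s := Ioi 0))
  simp only [sub_zero, add_zero] at h3
  have key : ∀ p q : ℝ, (∫ u in (0 : ℝ)..q, g u) - (∫ u in (0 : ℝ)..p, g u) = ∫ u in p..q, g u :=
    fun p q => integral_interval_sub_left (hg.intervalIntegrable _ _) (hg.intervalIntegrable _ _)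
  simpa only [key] using h3

lemma sin_ne_zero_of_mem_uIcc {δ : ℝ} (h0 : 0 < δ) (h1 : δ < Real.pi / 2) {u : ℝ}
    (hu : u ∈ uIcc δ (Real.pi - δ)) : Real.sin u ≠ 0 := by
  rw [uIcc_of_le (by linarith)] at hu
  exact (Real.sin_pos_of_pos_of_lt_pi (by linarith [hu.1]) (by linarith [hu.2])).ne'

/-- The kernel `cot u · exp (2 i m u)`. -/
noncomputable def cotCharacter (m : ℤ) (u : ℝ) : ℂ :=
  ((Real.cos u / Real.sin u : ℝ) : ℂ) * evenCharacter m u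

/-- The kernel `cos u / sin³ u · exp (2 i m u)`. -/
noncomputable def cubicCharacter (m : ℤ) (u : ℝ) : ℂ :=
  ((Real.cos u / Real.sin u ^ 3 : ℝ) : ℂ) * evenCharacter m u

lemma cotCharacter_intervalIntegrable (m : ℤ) {δ : ℝ} (h0 : 0 < δ) (h1 : δ < Real.pi / 2) :
    IntervalIntegrable (cotCharacter m) MeasureTheory.volume δ (Real.pi - δ) := by
  apply ContinuousOn.intervalIntegrable
  refine ContinuousOn.mul ?_ (evenCharacter_continuous m).continuousOn
  exact Complex.continuous_ofReal.comp_continuousOn (Real.continuous_cos.continuousOn.div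
    Real.continuous_sin.continuousOn fun u hu => sin_ne_zero_of_mem_uIcc h0 h1 hu)

lemma cubicCharacter_continuousAt (m : ℤ) {u : ℝ} (hu : Real.sin u ≠ 0) :
    ContinuousAt (cubicCharacter m) u := by
  refine ContinuousAt.mul ?_ (evenCharacter_continuous m).continuousAt
  exact Complex.continuous_ofReal.continuousAt.comp (Real.continuous_cos.continuousAt.div
    (Real.continuous_sin.pow 3).continuousAt (pow_ne_zero _ hu))

lemma eventually_small (c : ℝ) (hc : 0 < c) : ∀ᶠ δ : ℝ in 𝓝[>] 0, 0 < δ ∧ δ < c := by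
  filter_upwards [Ioo_mem_nhdsGT hc] with δ hδ using hδ

lemma integral_cotCharacter_zero {δ : ℝ} (h0 : 0 < δ) (h1 : δ < Real.pi / 2) :
    ∫ u in δ..(Real.pi - δ), cotCharacter 0 u = 0 := by
  have h : ∀ u ∈ uIcc δ (Real.pi - δ),
      HasDerivAt (fun x : ℝ => ((Real.log (Real.sin x) : ℝ) : ℂ)) (cotCharacter 0 u) u := by
    intro u hu
    convert ((Real.hasDerivAt_sin u).log (sin_ne_zero_of_mem_uIcc h0 h1 hu)).ofReal_comp using 1
    simp [cotCharacter, evenCharacter]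
  rw [integral_eq_sub_of_hasDerivAt h (cotCharacter_intervalIntegrable 0 h0 h1), Real.sin_pi_sub,
    sub_self]

lemma cotCharacter_succ_sub (m : ℤ) {u : ℝ} (hu : Real.sin u ≠ 0) :
    cotCharacter (m + 1) u - cotCharacter m u =
      Complex.I * (evenCharacter (m + 1) u + evenCharacter m u) := by
  have hs : Complex.sin u ≠ 0 := by
    rw [← Complex.ofReal_sin]
    exact_mod_cast hu
  simp only [cotCharacter, evenCharacter_succ]
  push_cast
  field_simp
  have h1 := Complex.sin_sq_add_cos_sq (u : ℂ)
  have h2 := Complex.I_sq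
  linear_combination evenCharacter m u * (Complex.cos u + Complex.I * Complex.sin u) * h1
    - evenCharacter m u * Complex.sin u ^ 2 * (Complex.cos u + Complex.I * Complex.sin u) * h2

lemma tendsto_integral_cotCharacter_succ_sub (m : ℤ) :
    Tendsto (fun δ : ℝ => (∫ u in δ..(Real.pi - δ), cotCharacter (m + 1) u)
        - ∫ u in δ..(Real.pi - δ), cotCharacter m u) (𝓝[>] 0)
      (𝓝 (Complex.I * ((if m + 1 = 0 then (Real.pi : ℂ) else 0) + if m = 0 then (Real.pi : ℂ) else 0))) := by
  have h := tendsto_integral_shrinking (g := fun u => Complex.I * (evenCharacter (m + 1) u + evenCharacter m u))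
    (continuous_const.mul ((evenCharacter_continuous _).add (evenCharacter_continuous _))) 0 Real.pi
  rw [integral_const_mul, integral_add ((evenCharacter_continuous _).intervalIntegrable _ _)
    ((evenCharacter_continuous _).intervalIntegrable _ _), integral_evenCharacter,
    integral_evenCharacter] at h
  refine h.congr' ?_
  filter_upwards [eventually_small (Real.pi / 2) (by positivity)] with δ ⟨h0, h1⟩
  rw [← integral_sub (cotCharacter_intervalIntegrable _ h0 h1) (cotCharacter_intervalIntegrable _ h0 h1),
    zero_add]
  exact integral_congr fun u hu => (cotCharacter_succ_sub m (sin_ne_zero_of_mem_uIcc h0 h1 hu)).symm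

lemma tendsto_integral_cotCharacter (m : ℤ) :
    Tendsto (fun δ : ℝ => ∫ u in δ..(Real.pi - δ), cotCharacter m u) (𝓝[>] 0)
      (𝓝 (Complex.I * Real.pi * (Int.sign m : ℂ))) := by
  induction m using Int.induction_on with
  | zero =>
    simp only [Int.sign_zero, Int.cast_zero, mul_zero]
    refine tendsto_const_nhds.congr' ?_
    filter_upwards [eventually_small (Real.pi / 2) (by positivity)] with δ ⟨h0, h1⟩
    exact (integral_cotCharacter_zero h0 h1).symm
  | succ n ih =>
    have h := (tendsto_integral_cotCharacter_succ_sub n).add ih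
    simp only [sub_add_cancel] at h
    convert h using 2
    have h1 : (n : ℤ) + 1 ≠ 0 := by omega
    rw [if_neg h1, Int.sign_eq_one_of_pos (by omega : 0 < (n : ℤ) + 1)]
    rcases Nat.eq_zero_or_pos n with rfl | hn
    · simp
    · rw [Int.sign_eq_one_of_pos (by omega : 0 < (n : ℤ)), if_neg (by omega)]
      simp
  | pred n ih =>
    have h := ih.sub (tendsto_integral_cotCharacter_succ_sub (-(n : ℤ) - 1))
    simp only [sub_add_cancel, sub_sub_cancel] at h
    convert h using 2
    have h1 : -(n : ℤ) - 1 ≠ 0 := by omega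
    rw [if_neg h1, Int.sign_eq_neg_one_of_neg (by omega : -(n : ℤ) - 1 < 0)]
    rcases Nat.eq_zero_or_pos n with rfl | hn
    · simp
    · rw [Int.sign_eq_neg_one_of_neg (by omega : -(n : ℤ) < 0), if_neg (by omega)]
      simp

lemma integral_cubicCharacter (m : ℤ) {δ : ℝ} (h0 : 0 < δ) (h1 : δ < Real.pi / 2) :
    ∫ u in δ..(Real.pi - δ), cubicCharacter m u =
      Complex.I * ((Real.sin (2 * m * δ) / Real.sin δ ^ 2
        + 2 * m * (Real.cos δ * Real.cos (2 * m * δ) / Real.sin δ) : ℝ) : ℂ)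
      - 2 * (m : ℂ) ^ 2 * ∫ u in δ..(Real.pi - δ), cotCharacter m u := by
  set B : ℝ → ℂ := fun u => (((-1 / 2) / Real.sin u ^ 2 : ℝ) : ℂ) * evenCharacter m u
    - Complex.I * m * (((Real.cos u / Real.sin u : ℝ) : ℂ) * evenCharacter m u) with hB
  have hd : ∀ u ∈ uIcc δ (Real.pi - δ),
      HasDerivAt B (cubicCharacter m u + 2 * (m : ℂ) ^ 2 * cotCharacter m u) u := by
    intro u hu
    have hs := sin_ne_zero_of_mem_uIcc h0 h1 hu
    have hs' : Complex.sin u ≠ 0 := by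
      rw [← Complex.ofReal_sin]
      exact_mod_cast hs
    have d1 := (((hasDerivAt_const u (-1 / 2 : ℝ)).div ((Real.hasDerivAt_sin u).pow 2)
      (pow_ne_zero 2 hs)).ofReal_comp).mul (evenCharacter_hasDerivAt m u)
    have d2 := (((Real.hasDerivAt_cos u).div (Real.hasDerivAt_sin u) hs).ofReal_comp).mul
      (evenCharacter_hasDerivAt m u)
    refine (d1.sub (d2.const_mul (Complex.I * m))).congr_deriv ?_
    simp only [cubicCharacter, cotCharacter, Pi.pow_apply, Pi.div_apply]
    push_cast
    field_simp
    ring_nf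
    simp only [Complex.cos_sq', Complex.I_sq]
    ring
  have hi1 : IntervalIntegrable (cubicCharacter m) MeasureTheory.volume δ (Real.pi - δ) :=
    ContinuousOn.intervalIntegrable fun u hu =>
      (cubicCharacter_continuousAt m (sin_ne_zero_of_mem_uIcc h0 h1 hu)).continuousWithinAt
  have hi2 := (cotCharacter_intervalIntegrable m h0 h1).const_mul (2 * (m : ℂ) ^ 2)
  have h := integral_eq_sub_of_hasDerivAt hd (hi1.add hi2)
  rw [integral_add hi1 hi2, integral_const_mul] at h
  rw [eq_sub_iff_add_eq, h]
  simp only [hB, evenCharacter_pi_sub, Real.sin_pi_sub, Real.cos_pi_sub]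
  simp only [evenCharacter_eq, mul_neg, Real.sin_neg, Real.cos_neg]
  push_cast
  have hs : Complex.sin δ ≠ 0 := by
    rw [← Complex.ofReal_sin]
    exact_mod_cast sin_ne_zero_of_mem_uIcc h0 h1 left_mem_uIcc
  field_simp
  ring

lemma tendsto_sin_mul_sub_div_sq (c : ℝ) :
    Tendsto (fun x : ℝ => (Real.sin (c * x) - c * x) / x ^ 2) (𝓝[>] 0) (𝓝 0) := by
  have hb : ∀ᶠ x : ℝ in 𝓝[>] 0, |c * x| ≤ 1 := by
    have : Tendsto (fun x : ℝ => |c * x|) (𝓝[>] 0) (𝓝 0) := by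
      have h : Continuous fun x : ℝ => |c * x| := by fun_prop
      simpa using (h.tendsto 0).mono_left (nhdsWithin_le_nhds (s := Ioi 0))
    exact (this.eventually (gt_mem_nhds one_pos)).mono fun _ h => h.le
  refine squeeze_zero_norm' (a := fun x : ℝ => |c| ^ 3 * x) ?_ ?_
  · filter_upwards [hb, self_mem_nhdsWithin] with x hx h0
    have h0 : 0 < x := h0
    rw [norm_div, Real.norm_eq_abs, norm_pow, Real.norm_eq_abs, sq_abs, div_le_iff₀ (by positivity)]
    have h1 := Real.sin_bound hx
    have h2 : |c * x| ^ 5 ≤ |c * x| ^ 3 := pow_le_pow_of_le_one (abs_nonneg _) hx (by norm_num)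
    have h3 : |(c * x) ^ 3 / 6| = |c * x| ^ 3 / 6 := by rw [abs_div, abs_pow]; norm_num
    have h4 : |c * x| ^ 3 = |c| ^ 3 * x * x ^ 2 := by
      rw [abs_mul, abs_of_pos h0]; ring
    have h5 : 0 ≤ |c * x| ^ 3 := by positivity
    rw [← h4]
    have h6 := abs_sub (Real.sin (c * x) - (c * x - (c * x) ^ 3 / 6)) ((c * x) ^ 3 / 6)
    rw [h3, show Real.sin (c * x) - (c * x - (c * x) ^ 3 / 6) - (c * x) ^ 3 / 6
      = Real.sin (c * x) - c * x by ring] at h6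
    linarith
  · have h : Continuous fun x : ℝ => |c| ^ 3 * x := by fun_prop
    simpa using (h.tendsto 0).mono_left (nhdsWithin_le_nhds (s := Ioi 0))

lemma tendsto_self_div_sin : Tendsto (fun x : ℝ => x / Real.sin x) (𝓝[>] 0) (𝓝 1) := by
  have h := (Real.hasDerivAt_sin 0).tendsto_slope.mono_left
    (nhdsWithin_mono 0 (fun x (hx : x ∈ Ioi (0 : ℝ)) => ne_of_gt hx))
  rw [Real.cos_zero] at h
  have h2 := h.inv₀ one_ne_zero
  rw [inv_one] at h2
  refine h2.congr fun x => ?_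
  simp [slope_def_field]

lemma tendsto_sin_mul_div_sin_sq_sub (c : ℝ) :
    Tendsto (fun x : ℝ => Real.sin (c * x) / Real.sin x ^ 2 - c / x) (𝓝[>] 0) (𝓝 0) := by
  have h1 := tendsto_sin_mul_sub_div_sq c
  have h2 := tendsto_sin_mul_sub_div_sq 1
  have h3 := tendsto_self_div_sin
  have h := (h1.mul (h3.pow 2)).sub (((h2.mul (h3.pow 2)).add (h2.mul h3)).const_mul c)
  simp only [zero_mul, add_zero, mul_zero, sub_zero] at h
  refine h.congr' ?_
  filter_upwards [eventually_small Real.pi Real.pi_pos] with x ⟨h0, hp⟩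
  have hs := (Real.sin_pos_of_pos_of_lt_pi h0 hp).ne'
  have hx := h0.ne'
  simp only [one_mul]
  field_simp
  ring

lemma tendsto_cos_mul_cos_div_sin_sub (c : ℝ) :
    Tendsto (fun x : ℝ => Real.cos x * Real.cos (c * x) / Real.sin x - 1 / x) (𝓝[>] 0) (𝓝 0) := by
  have h1 : HasDerivAt (fun x : ℝ => Real.cos x * Real.cos (c * x)) 0 0 := by
    have := (Real.hasDerivAt_cos 0).mul (((hasDerivAt_id (0 : ℝ)).const_mul c).cos)
    exact this.congr_deriv (by simp)
  have h1 := h1.tendsto_slope.mono_left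
    (nhdsWithin_mono 0 (fun x (hx : x ∈ Ioi (0 : ℝ)) => ne_of_gt hx))
  have h := (h1.sub (tendsto_sin_mul_sub_div_sq 1)).mul tendsto_self_div_sin
  simp only [sub_zero, zero_mul] at h
  refine h.congr' ?_
  filter_upwards [eventually_small Real.pi Real.pi_pos] with x ⟨h0, hp⟩
  have hs := (Real.sin_pos_of_pos_of_lt_pi h0 hp).ne'
  have hx := h0.ne'
  simp only [one_mul, slope_def_field, mul_zero, Real.cos_zero, sub_zero]
  field_simp
  ring

lemma tendsto_integral_cubicCharacter (m : ℤ) :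
    Tendsto (fun δ : ℝ => (∫ u in δ..(Real.pi - δ), cubicCharacter m u)
        - Complex.I * ((4 * m / δ : ℝ) : ℂ)) (𝓝[>] 0)
      (𝓝 (-(2 * (m : ℂ) ^ 2 * (Complex.I * Real.pi * (Int.sign m : ℂ))))) := by
  have h1 := (tendsto_sin_mul_div_sin_sq_sub (2 * m)).add
    ((tendsto_cos_mul_cos_div_sin_sub (2 * m)).const_mul (2 * m : ℝ))
  have h2 := ((Complex.continuous_ofReal.tendsto _).comp h1).const_mul Complex.I
  have h := h2.sub ((tendsto_integral_cotCharacter m).const_mul (2 * (m : ℂ) ^ 2))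
  simp only [mul_zero, add_zero, Complex.ofReal_zero, zero_sub] at h
  refine h.congr' ?_
  filter_upwards [eventually_small (Real.pi / 2) (by positivity)] with δ ⟨h0, hp⟩
  rw [integral_cubicCharacter m h0 hp]
  simp only [Function.comp]
  push_cast
  ring

lemma cubicCharacter_add_pi (m : ℤ) (u : ℝ) :
    cubicCharacter m (u + Real.pi) = cubicCharacter m u := by
  simp only [cubicCharacter, evenCharacter_add_pi, Real.cos_add_pi, Real.sin_add_pi]
  congr 2
  rw [Odd.neg_pow (by decide), neg_div_neg_eq]

/-- The integral of the kernel over one period with a symmetric gap around the pole. -/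
lemma integral_gap_eq {a b t T : ℝ} (hT : T = b - a) (m : ℤ) {ε : ℝ}
    (h0 : 0 < ε) (ha : ε < t - a) (hb : ε < b - t) :
    (∫ x in a..(t - ε), cubicCharacter m (Real.pi / T * x - Real.pi / T * t))
      + (∫ x in (t + ε)..b, cubicCharacter m (Real.pi / T * x - Real.pi / T * t)) =
    (T / Real.pi : ℝ) • ∫ u in (Real.pi / T * ε)..(Real.pi - Real.pi / T * ε), cubicCharacter m u := by
  have hT0 : 0 < T := by linarith
  have hk : 0 < Real.pi / T := by positivity
  have hkT : Real.pi / T * T = Real.pi := by field_simp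
  set k := Real.pi / T with hk_def
  have hi : ∀ p q : ℝ, t + ε ≤ p → p ≤ q → q ≤ t + T - ε →
      IntervalIntegrable (fun x => cubicCharacter m (k * x - k * t)) MeasureTheory.volume p q := by
    intro p q hp hpq hq
    apply ContinuousOn.intervalIntegrable
    intro x hx
    rw [uIcc_of_le hpq] at hx
    apply ContinuousAt.continuousWithinAt
    have hs : Real.sin (k * x - k * t) ≠ 0 := by
      apply (Real.sin_pos_of_pos_of_lt_pi _ _).ne'
      · rw [← mul_sub]
        exact mul_pos hk (by linarith [hx.1])
      · rw [← mul_sub, ← hkT]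
        exact mul_lt_mul_of_pos_left (by linarith [hx.2]) hk
    exact (cubicCharacter_continuousAt m hs).comp (f := fun x => k * x - k * t) (by fun_prop)
  have hshift : (∫ x in a..(t - ε), cubicCharacter m (k * x - k * t)) =
      ∫ x in b..(t + T - ε), cubicCharacter m (k * x - k * t) := by
    have := integral_comp_add_right (a := a) (b := t - ε)
      (fun x => cubicCharacter m (k * x - k * t)) T
    rw [show a + T = b by linarith, show t - ε + T = t + T - ε by ring] at this
    rw [← this]
    congr 1
    ext x
    rw [← cubicCharacter_add_pi]
    congr 1
    rw [mul_add, hkT]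
    ring
  rw [hshift, add_comm, integral_add_adjacent_intervals (hi _ _ le_rfl (by linarith) (by linarith))
    (hi _ _ (by linarith) (by linarith) le_rfl), integral_comp_mul_sub _ hk.ne']
  congr 1
  · rw [hk_def, inv_div]
  · congr 1
    · ring
    · rw [← hkT]; ring

/-- The Hadamard finite part of `∫ₐᵇ f_m`, where
`f_m(x) = cos(π(x-t)/T)/sin³(π(x-t)/T) · e^{i2mπx/T}`, exists and equals
`-i·sgn(m)·2T·m²·e^{i2mπt/T}`. -/
theorem hadamard_finite_part_of_kernel_times_em
    (a b t : ℝ) (hab : a < b) (ht : t ∈ Set.Ioo a b)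
    (T : ℝ) (hT : T = b - a) (m : ℤ)
    (e : ℝ → ℂ)
    (he : ∀ x : ℝ, e x = Complex.exp (Complex.I * ((2 * (m : ℝ) * Real.pi * x / T : ℝ) : ℂ)))
    (f : ℝ → ℂ)
    (hf : ∀ x : ℝ, x ≠ t → f x =
      ((Real.cos (Real.pi * (x - t) / T) / (Real.sin (Real.pi * (x - t) / T)) ^ 3 : ℝ) : ℂ) * e x) :
    Filter.Tendsto
      (fun ε : ℝ =>
        (∫ x in a..(t - ε), f x) + (∫ x in (t + ε)..b, f x)
          - Complex.I * ((4 * (m : ℝ) * T ^ 2 / Real.pi ^ 2 : ℝ) : ℂ) * e t / (ε : ℂ))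
      (nhdsWithin 0 (Set.Ioi 0))
      (nhds (-Complex.I * (Int.sign m : ℂ) * 2 * (T : ℂ) * (m : ℂ) ^ 2 * e t)) := by
  have hT0 : 0 < T := by linarith
  have hk : 0 < Real.pi / T := by positivity
  have hfe : ∀ x : ℝ, x ≠ t →
      f x = e t * cubicCharacter m (Real.pi / T * x - Real.pi / T * t) := by
    intro x hx
    rw [hf x hx, he x, he t, cubicCharacter, evenCharacter,
      show Real.pi * (x - t) / T = Real.pi / T * x - Real.pi / T * t by ring, mul_left_comm,
      ← Complex.exp_add]
    congr 2
    push_cast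
    ring
  have hδ : Tendsto (fun ε : ℝ => Real.pi / T * ε) (𝓝[>] 0) (𝓝[>] 0) := by
    refine tendsto_nhdsWithin_iff.2 ⟨?_, ?_⟩
    · have h : Continuous fun ε : ℝ => Real.pi / T * ε := by fun_prop
      simpa using (h.tendsto 0).mono_left (nhdsWithin_le_nhds (s := Ioi 0))
    · filter_upwards [self_mem_nhdsWithin] with ε hε using mul_pos hk hε
  have h := ((tendsto_integral_cubicCharacter m).comp hδ).const_mul
    (e t * ((T / Real.pi : ℝ) : ℂ))
  have hpi : (Real.pi : ℂ) ≠ 0 := by exact_mod_cast Real.pi_ne_zero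
  have hTc : (T : ℂ) ≠ 0 := by exact_mod_cast hT0.ne'
  convert h.congr' ?_ using 2
  · push_cast
    field_simp
  · filter_upwards [eventually_small (t - a) (by linarith [ht.1]),
      eventually_small (b - t) (by linarith [ht.2])] with ε ⟨h0, ha⟩ ⟨_, hb⟩
    have hl : (∫ x in a..(t - ε), f x) =
        e t * ∫ x in a..(t - ε), cubicCharacter m (Real.pi / T * x - Real.pi / T * t) := by
      rw [← integral_const_mul]
      refine integral_congr fun x hx => hfe x ?_
      rw [uIcc_of_le (by linarith)] at hx
      exact (show x < t by linarith [hx.2]).ne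
    have hr : (∫ x in (t + ε)..b, f x) =
        e t * ∫ x in (t + ε)..b, cubicCharacter m (Real.pi / T * x - Real.pi / T * t) := by
      rw [← integral_const_mul]
      refine integral_congr fun x hx => hfe x ?_
      rw [uIcc_of_le (by linarith)] at hx
      exact (show t < x by linarith [hx.1]).ne'
    have hε : (ε : ℂ) ≠ 0 := by exact_mod_cast h0.ne'
    rw [hl, hr, ← mul_add, integral_gap_eq hT m h0 ha hb, Complex.real_smul]
    simp only [Function.comp]
    push_cast
    field_simp
end

section
/- Let $a<b$, $T=b-a$, and $t\in(a,b)$. Then the Hadamard finite part of $\int_a^b \csc^{2}\frac{\pi(x-t)}{T}\,dx$ vanishes; precisely, $\lim_{\varepsilon\to 0^{+}}\Big[\int_a^{t-\varepsilon}\frac{dx}{\sin^{2}\frac{\pi(x-t)}{T}}+\int_{t+\varepsilon}^{b}\frac{dx}{\sin^{2}\frac{\pi(x-t)}{T}}-\frac{2T^{2}}{\pi^{2}\varepsilon}\Big]=0$. -/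
/-- The cotangent agrees with its principal part `1 / s` up to `o(1)` as `s → 0⁺`. -/
theorem tendsto_cos_div_sin_sub_inv :
    Filter.Tendsto (fun s : ℝ => Real.cos s / Real.sin s - 1 / s)
      (nhdsWithin 0 (Set.Ioi 0)) (nhds 0) := by
  have hlow : Filter.Tendsto (fun s : ℝ => -(s / 2)) (nhdsWithin 0 (Set.Ioi 0)) (nhds 0) := by
    have h : Continuous (fun s : ℝ => -(s / 2)) := by fun_prop
    simpa using (h.tendsto 0).mono_left nhdsWithin_le_nhds
  have hmem : ∀ᶠ s : ℝ in nhdsWithin 0 (Set.Ioi 0), s ∈ Set.Ioo (0 : ℝ) 1 :=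
    Ioo_mem_nhdsGT one_pos
  refine tendsto_of_tendsto_of_tendsto_of_le_of_le' hlow tendsto_const_nhds ?_ ?_
  · filter_upwards [hmem] with s hs
    have hs0 := hs.1
    have hsin : 0 < Real.sin s :=
      Real.sin_pos_of_pos_of_lt_pi hs0 (by linarith [hs.2, Real.pi_gt_three])
    have hcos := Real.one_sub_sq_div_two_le_cos (x := s)
    have hcos0 : 0 ≤ Real.cos s := by nlinarith [hs.1, hs.2]
    have h1 : Real.cos s / s ≤ Real.cos s / Real.sin s :=
      div_le_div_of_nonneg_left hcos0 hsin (Real.sin_lt hs0).le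
    have h2 : (1 - s ^ 2 / 2) / s ≤ Real.cos s / s := by gcongr
    have h3 : (1 - s ^ 2 / 2) / s = 1 / s - s / 2 := by field_simp
    linarith
  · filter_upwards [hmem] with s hs
    have hs0 := hs.1
    have hsin : 0 < Real.sin s :=
      Real.sin_pos_of_pos_of_lt_pi hs0 (by linarith [hs.2, Real.pi_gt_three])
    have hlt : s < Real.pi / 2 := by linarith [hs.2, Real.pi_gt_three]
    have hcos : 0 < Real.cos s := Real.cos_pos_of_mem_Ioo ⟨by linarith, hlt⟩
    have htan := Real.lt_tan hs0 hlt
    rw [Real.tan_eq_sin_div_cos, lt_div_iff₀ hcos] at htan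
    rw [sub_nonpos, div_le_div_iff₀ hsin hs0]
    linarith

/-- The integral of `csc²` over an interval on which the sine does not vanish. -/
theorem integral_one_div_sin_sq_of_ne_zero {t T c d : ℝ} (hT : T ≠ 0)
    (h : ∀ x ∈ Set.uIcc c d, Real.sin (Real.pi * (x - t) / T) ≠ 0) :
    ∫ x in c..d, 1 / (Real.sin (Real.pi * (x - t) / T)) ^ 2 =
      T / Real.pi * (Real.cos (Real.pi * (c - t) / T) / Real.sin (Real.pi * (c - t) / T)
        - Real.cos (Real.pi * (d - t) / T) / Real.sin (Real.pi * (d - t) / T)) := by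
  rw [intervalIntegral.integral_eq_sub_of_hasDerivAt
    (f := fun x => -(T / Real.pi) *
      (Real.cos (Real.pi * (x - t) / T) / Real.sin (Real.pi * (x - t) / T)))]
  · ring
  · intro x hx
    have hs := h x hx
    have hlin : HasDerivAt (fun x : ℝ => Real.pi * (x - t) / T) (Real.pi / T) x := by
      simpa using (((hasDerivAt_id x).sub_const t).const_mul Real.pi).div_const T
    refine ((hlin.cos.div hlin.sin hs).const_mul (-(T / Real.pi))).congr_deriv ?_
    have hpi := Real.pi_ne_zero
    field_simp
    linarith [Real.sin_sq_add_cos_sq (Real.pi * (x - t) / T)]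
  · refine ContinuousOn.intervalIntegrable ?_
    exact continuousOn_const.div (by fun_prop) fun x hx => pow_ne_zero 2 (h x hx)

/-- The Hadamard finite part of `∫ₐᵇ csc²(π(x-t)/T) dx` vanishes. -/
theorem finite_part_csc_sq_eq_zero
    (a b t : ℝ) (hab : a < b) (ht : t ∈ Set.Ioo a b) (T : ℝ) (hT : T = b - a) :
    Filter.Tendsto
      (fun ε : ℝ =>
        (∫ x in a..(t - ε), 1 / (Real.sin (Real.pi * (x - t) / T)) ^ 2)
          + (∫ x in (t + ε)..b, 1 / (Real.sin (Real.pi * (x - t) / T)) ^ 2)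
          - 2 * T ^ 2 / (Real.pi ^ 2 * ε))
      (nhdsWithin 0 (Set.Ioi 0)) (nhds 0) := by
  obtain ⟨hat, htb⟩ := ht
  have hT0 : 0 < T := by linarith
  have hpi := Real.pi_pos
  have hscale : Filter.Tendsto (fun ε : ℝ => Real.pi * ε / T)
      (nhdsWithin 0 (Set.Ioi 0)) (nhdsWithin 0 (Set.Ioi 0)) := by
    refine tendsto_nhdsWithin_iff.2 ⟨?_, ?_⟩
    · have h : Continuous (fun ε : ℝ => Real.pi * ε / T) := by fun_prop
      simpa using (h.tendsto 0).mono_left nhdsWithin_le_nhds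
    · filter_upwards [self_mem_nhdsWithin] with ε hε
      have hε0 : 0 < ε := hε
      exact Set.mem_Ioi.2 (by positivity)
  have hlim := (tendsto_cos_div_sin_sub_inv.comp hscale).const_mul (2 * T / Real.pi)
  rw [mul_zero] at hlim
  refine hlim.congr' ?_
  filter_upwards [Ioo_mem_nhdsGT (sub_pos.2 hat), Ioo_mem_nhdsGT (sub_pos.2 htb)]
    with ε hεa hεb
  have hε : 0 < ε := hεa.1
  have hleft : ∀ x ∈ Set.uIcc a (t - ε), Real.sin (Real.pi * (x - t) / T) ≠ 0 := by
    intro x hx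
    rw [Set.uIcc_of_le (by linarith [hεa.2])] at hx
    refine (Real.sin_neg_of_neg_of_neg_pi_lt ?_ ?_).ne
    · rw [div_lt_iff₀ hT0]
      nlinarith [hx.2]
    · rw [lt_div_iff₀ hT0]
      nlinarith [hx.1]
  have hright : ∀ x ∈ Set.uIcc (t + ε) b, Real.sin (Real.pi * (x - t) / T) ≠ 0 := by
    intro x hx
    rw [Set.uIcc_of_le (by linarith [hεb.2])] at hx
    refine (Real.sin_pos_of_pos_of_lt_pi ?_ ?_).ne'
    · exact div_pos (mul_pos hpi (by linarith [hx.1])) hT0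
    · rw [div_lt_iff₀ hT0]
      nlinarith [hx.2]
  rw [integral_one_div_sin_sq_of_ne_zero hT0.ne' hleft,
    integral_one_div_sin_sq_of_ne_zero hT0.ne' hright]
  have hperiod : Real.pi * (b - t) / T = Real.pi * (a - t) / T + Real.pi := by
    have hb : b = a + T := by linarith
    rw [hb]
    field_simp
    ring
  have hneg : Real.pi * (t - ε - t) / T = -(Real.pi * ε / T) := by ring
  have hpos : Real.pi * (t + ε - t) / T = Real.pi * ε / T := by ring
  have hpole : 2 * T ^ 2 / (Real.pi ^ 2 * ε) = 2 * T / Real.pi * (1 / (Real.pi * ε / T)) := by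
    field_simp
  rw [hperiod, hneg, hpos, hpole, Real.cos_add_pi, Real.sin_add_pi, Real.cos_neg, Real.sin_neg,
    neg_div_neg_eq, div_neg]
  simp only [Function.comp_apply]
  ring
end
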